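/- Let X be a nonempty compact metric space and f : X → X a continuous surjective map. Let μ be an f-invariant Borel probability measure on X and let μ̃ be an f̃-invariant Borel probability measure on X_f with π_* μ̃ = μ. Then the topological support of μ̃ equals X_f if and only if the topological support of μ equals X. -/

import Mathlib

open Function Set MeasureTheory

/-- The inverse limit (natural extension) of a map `f : X → X`, with the subspace
topology induced by the product topology on `X^ℤ`. -/
def InvLimit {X : Type*} (f : X → X) : Set (ℤ → X) :=
  {x | ∀ k : ℤ, f (x k) = x (k + 1)}

/-- The projection `π : X_f → X` onto the 0-th coordinate. -/
def InvLimit.proj {X : Type*} (f : X → X) (x : InvLimit f) : X := x.1 0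

/-- The shift map `f̃ : X_f → X_f`, `(f̃ x̃)_k = x_{k+1}`. -/
def InvLimit.shift {X : Type*} (f : X → X) (x : InvLimit f) : InvLimit f :=
  ⟨fun k => x.1 (k + 1), fun k => x.2 (k + 1)⟩

/-- We equip `X_f` with its Borel σ-algebra. -/
noncomputable instance {X : Type*} [MetricSpace X] (f : X → X) :
    MeasurableSpace (InvLimit f) := borel _

instance {X : Type*} [MetricSpace X] (f : X → X) : BorelSpace (InvLimit f) := ⟨rfl⟩

namespace InvLimit

variable {X : Type*} {f : X → X}

theorem iterate_coord (x : InvLimit f) (k : ℤ) (n : ℕ) : f^[n] (x.1 k) = x.1 (k + n) := by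
  induction n with
  | zero => simp
  | succ n ih =>
    rw [iterate_succ_apply', ih, x.2]
    exact congrArg x.1 (by push_cast; ring)

theorem proj_surjective (hsurj : Surjective f) : Surjective (proj f) := by
  obtain ⟨g, hg⟩ := hsurj.hasRightInverse
  intro x
  let y : ℤ → X
    | Int.ofNat n => f^[n] x
    | Int.negSucc n => g^[n + 1] x
  refine ⟨⟨y, ?_⟩, rfl⟩
  rintro (n | _ | n)
  · exact (iterate_succ_apply' f n x).symm
  · exact hg x
  · change f (g^[n + 1 + 1] x) = g^[n + 1] x
    rw [iterate_succ_apply' g (n + 1), hg]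

theorem continuous_coord [TopologicalSpace X] (k : ℤ) :
    Continuous fun x : InvLimit f => x.1 k :=
  (continuous_apply k).comp continuous_subtype_val

theorem continuous_shift [TopologicalSpace X] : Continuous (shift f) :=
  Continuous.subtype_mk (continuous_pi fun k => continuous_coord (k + 1)) _

/-- The preimages of open sets under the coordinates of nonpositive index form a basis of the
topology of the inverse limit. -/
theorem exists_coord_preimage_subset [TopologicalSpace X] (hf : Continuous f)
    {U : Set (InvLimit f)} (hU : IsOpen U) {x : InvLimit f} (hx : x ∈ U) :
    ∃ (N : ℕ) (W : Set X), IsOpen W ∧ x.1 (-N) ∈ W ∧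
      (fun y : InvLimit f => y.1 (-N)) ⁻¹' W ⊆ U := by
  obtain ⟨O, hO, rfl⟩ := isOpen_induced_iff.1 hU
  obtain ⟨I, u, hu, hIu⟩ := isOpen_pi_iff.1 hO x.1 hx
  let N : ℕ := I.sup Int.natAbs
  have coord_eq (y : InvLimit f) {i : ℤ} (hi : i ∈ I) :
      f^[(i + N).toNat] (y.1 (-N)) = y.1 i := by
    have hN : i.natAbs ≤ N := Finset.le_sup (f := Int.natAbs) hi
    rw [iterate_coord]
    exact congrArg y.1 (by omega)
  refine ⟨N, ⋂ i ∈ I, f^[(i + N).toNat] ⁻¹' u i, ?_, ?_, ?_⟩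
  · exact isOpen_biInter_finset fun i hi => (hu i hi).1.preimage (hf.iterate _)
  · refine mem_iInter₂.2 fun i hi => ?_
    rw [mem_preimage, coord_eq x hi]
    exact (hu i hi).2
  · intro y hy
    refine hIu fun i hi => ?_
    have hyi := mem_iInter₂.1 hy i hi
    rwa [mem_preimage, coord_eq y hi] at hyi

theorem map_coord_neg [MetricSpace X] [MeasurableSpace X] [BorelSpace X]
    {ν : Measure (InvLimit f)} (hν : ν.map (shift f) = ν) (N : ℕ) :
    ν.map (fun x : InvLimit f => x.1 (-N)) = ν.map (proj f) := by
  induction N with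
  | zero => rfl
  | succ N ih =>
    rw [← ih]
    conv_lhs => rw [← hν]
    rw [Measure.map_map (continuous_coord _).measurable continuous_shift.measurable]
    congr 1
    funext x
    change x.1 (-((N + 1 : ℕ) : ℤ) + 1) = x.1 (-N)
    exact congrArg x.1 (by push_cast; ring)

end InvLimit

/-- The topological support of `μ̃` is all of `X_f` if and only if the topological
support of `μ` is all of `X`; having full support is expressed as: every nonempty
open set has positive measure. -/
theorem stmt5 {X : Type*} [MetricSpace X] [CompactSpace X] [Nonempty X]
    [MeasurableSpace X] [BorelSpace X]
    (f : X → X) (hf : Continuous f) (hsurj : Function.Surjective f)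
    (μ : Measure X) [IsProbabilityMeasure μ] (hinv : μ.map f = μ)
    (μt : Measure (InvLimit f)) [IsProbabilityMeasure μt]
    (htinv : μt.map (InvLimit.shift f) = μt) (hproj : μt.map (InvLimit.proj f) = μ) :
    (∀ U : Set (InvLimit f), IsOpen U → U.Nonempty → 0 < μt U) ↔
      (∀ V : Set X, IsOpen V → V.Nonempty → 0 < μ V) := by
  constructor
  · intro h V hV hVne
    have hcont : Continuous (InvLimit.proj f) := InvLimit.continuous_coord 0
    rw [← hproj, Measure.map_apply hcont.measurable hV.measurableSet]
    exact h _ (hV.preimage hcont) (hVne.preimage (InvLimit.proj_surjective hsurj))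
  · rintro h U hU ⟨x, hx⟩
    obtain ⟨N, W, hW, hxW, hWU⟩ := InvLimit.exists_coord_preimage_subset hf hU hx
    refine lt_of_lt_of_le ?_ (measure_mono hWU)
    rw [← Measure.map_apply (InvLimit.continuous_coord _).measurable hW.measurableSet,
      InvLimit.map_coord_neg htinv, hproj]
    exact h W hW ⟨_, hxW⟩
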